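/- Let X be a nonempty set and T : X → X a map having exactly one fixed point x̄ and no other periodic points (i.e., x ≠ Tⁿ(x) for all n ≥ 1 and all x ≠ x̄). Then for every α ∈ (0,1) there exists a complete metric d on X such that d(T(x),T(y)) ≤ α·d(x,y) for all x, y ∈ X. -/

import Mathlib

theorem bessaga_phi {X : Type*} (T : X → X) (xbar : X)
    (hfx : T xbar = xbar)
    (hper : ∀ x : X, x ≠ xbar → ∀ n : ℕ, 1 ≤ n → T^[n] x ≠ x)
    (α : ℝ) (h0 : 0 < α) :
    ∃ φ : X → ℝ, (∀ x, 0 ≤ φ x) ∧ (∀ x, φ x = 0 ↔ x = xbar) ∧ ∀ x, φ (T x) ≤ α * φ x := by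
  classical
  let S : Setoid X :=
    { r := fun x y => ∃ m n : ℕ, T^[m] x = T^[n] y
      iseqv := by
        refine ⟨fun x => ⟨0, 0, rfl⟩, fun ⟨m, n, h⟩ => ⟨n, m, h.symm⟩, ?_⟩
        rintro x y z ⟨m, n, h⟩ ⟨p, q, k⟩
        refine ⟨p + m, n + q, ?_⟩
        rw [Function.iterate_add_apply, h, ← Function.iterate_add_apply, Nat.add_comm p n,
          Function.iterate_add_apply, k, ← Function.iterate_add_apply] }
  let r : X → X := fun x => (Quotient.mk S x).out
  have hr : ∀ x, ∃ m n : ℕ, T^[m] x = T^[n] (r x) := fun x =>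
    S.symm (Quotient.mk_out (s := S) x)
  have hrT : ∀ x, r (T x) = r x := fun x => by
    have : Quotient.mk S (T x) = Quotient.mk S x := Quotient.sound ⟨0, 1, rfl⟩
    simp only [r, this]
  choose a b hab using hr
  have hbarit : ∀ n, T^[n] xbar = xbar := fun n => Function.iterate_fixed hfx n
  -- key: orbit injectivity
  have hlt : ∀ y i j, i < j → T^[i] y = T^[j] y → T^[i] y = xbar := by
    intro y i j hij h
    by_contra hne
    apply hper _ hne (j - i) (by omega)
    rw [← Function.iterate_add_apply, Nat.sub_add_cancel hij.le, h]
  have hinj : ∀ y, (∀ n, T^[n] y ≠ xbar) → ∀ i j, T^[i] y = T^[j] y → i = j := by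
    intro y hy i j h
    rcases lt_trichotomy i j with h1 | h1 | h1
    · exact absurd (hlt y i j h1 h) (hy i)
    · exact h1
    · exact absurd (hlt y j i h1 h.symm) (hy j)
  let P : X → Prop := fun x => ∃ n, T^[n] x = xbar
  let φ : X → ℝ := fun x =>
    if x = xbar then 0 else
    if h : P x then (α⁻¹) ^ (Nat.find h) else α ^ ((b x : ℤ) - a x)
  have hφbar : φ xbar = 0 := by simp [φ]
  have hpos : ∀ x, x ≠ xbar → 0 < φ x := by
    intro x hx
    simp only [φ, if_neg hx]
    split_ifs <;> positivity
  have hnn : ∀ x, 0 ≤ φ x := fun x => by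
    by_cases hx : x = xbar
    · rw [hx, hφbar]
    · exact (hpos x hx).le
  refine ⟨φ, hnn, fun x => ⟨fun h => ?_, fun h => h ▸ hφbar⟩, fun x => ?_⟩
  · by_contra hx
    exact (hpos x hx).ne' h
  by_cases hTx : T x = xbar
  · rw [hTx, hφbar]; exact mul_nonneg h0.le (hnn x)
  have hx : x ≠ xbar := fun h => hTx (by rw [h, hfx])
  by_cases hP : P x
  · have hPT : P (T x) := by
      obtain ⟨n, hn⟩ := hP
      exact ⟨n, by rw [← Function.iterate_succ_apply, Function.iterate_succ_apply', hn, hfx]⟩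
    have hf : Nat.find hP = Nat.find hPT + 1 := by
      rw [Nat.find_eq_iff]
      refine ⟨Nat.find_spec hPT, ?_⟩
      intro n hn h
      cases n with
      | zero => exact hx h
      | succ k => exact Nat.find_min hPT (m := k) (by omega) h
    simp only [φ, if_neg hTx, if_neg hx, dif_pos hP, dif_pos hPT, hf]
    rw [pow_succ]
    apply le_of_eq
    field_simp
  · have hPT : ¬ P (T x) := by
      rintro ⟨n, hn⟩
      exact hP ⟨n + 1, hn⟩
    have hPr : ∀ n, T^[n] (r x) ≠ xbar := by
      intro n hn
      apply hP
      refine ⟨n + a x, ?_⟩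
      rw [Function.iterate_add_apply, hab, ← Function.iterate_add_apply, Nat.add_comm,
        Function.iterate_add_apply, hn, hbarit]
    have e : a (T x) + 1 + b x = a x + b (T x) := by
      apply hinj _ hPr
      rw [Function.iterate_add_apply, ← hab, ← Function.iterate_add_apply,
        Nat.add_comm (a (T x) + 1), Function.iterate_add_apply, Function.iterate_succ_apply,
        hab (T x), hrT, ← Function.iterate_add_apply]
    simp only [φ, if_neg hTx, if_neg hx, dif_neg hP, dif_neg hPT]
    have e2 : (b (T x) : ℤ) - a (T x) = 1 + ((b x : ℤ) - a x) := by omega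
    rw [e2, zpow_add₀ h0.ne', zpow_one]

theorem stmt_5 {X : Type*} [Nonempty X] (T : X → X) (xbar : X)
    (hfix : ∀ x : X, T x = x ↔ x = xbar)
    (hper : ∀ x : X, x ≠ xbar → ∀ n : ℕ, 1 ≤ n → T^[n] x ≠ x)
    (α : ℝ) (hα : α ∈ Set.Ioo (0 : ℝ) 1) :
    ∃ d : MetricSpace X, @CompleteSpace X d.toUniformSpace ∧
      ∀ x y : X, d.dist (T x) (T y) ≤ α * d.dist x y := by
  classical
  obtain ⟨φ, hnn, hz, hT⟩ := bessaga_phi T xbar ((hfix xbar).2 rfl) hper α hα.1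
  let d : MetricSpace X :=
    { dist := fun x y => if x = y then 0 else φ x + φ y
      dist_self := fun x => by simp
      dist_comm := fun x y => by simp only [eq_comm (a := x), add_comm (φ x)]
      dist_triangle := fun x y z => by
        have := hnn x
        have := hnn y
        have := hnn z
        by_cases h1 : x = y
        · subst h1; simp
        by_cases h2 : y = z
        · subst h2; simp
        simp only [if_neg h1, if_neg h2]
        split_ifs <;> linarith
      eq_of_dist_eq_zero := fun {x y} h => by
        by_contra hne
        simp only [if_neg hne] at h
        have := hnn x
        have := hnn y
        exact hne (((hz x).1 (by linarith)).trans ((hz y).1 (by linarith)).symm) }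
  have hd : ∀ x y : X, dist x y = if x = y then 0 else φ x + φ y := fun x y => rfl
  refine ⟨d, ?_, fun x y => ?_⟩
  · apply Metric.complete_of_cauchySeq_tendsto
    intro u hu
    by_cases hc : ∃ N, ∀ n, N ≤ n → u n = u N
    · obtain ⟨N, hN⟩ := hc
      exact ⟨u N, tendsto_atTop_of_eventually_const hN⟩
    · push Not at hc
      refine ⟨xbar, ?_⟩
      rw [Metric.tendsto_atTop]
      intro ε hε
      obtain ⟨N, hN⟩ := Metric.cauchySeq_iff.1 hu ε hε
      refine ⟨N, fun m hm => ?_⟩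
      obtain ⟨n, hn, hne⟩ := hc m
      have h := hN n (hm.trans hn) m hm
      rw [hd, if_neg hne] at h
      have := hnn (u n)
      rw [hd, (hz xbar).2 rfl]
      split_ifs <;> linarith
  · change dist (T x) (T y) ≤ α * dist x y
    rw [hd, hd]
    have := hT x
    have := hT y
    by_cases h : x = y
    · simp [h]
    rw [if_neg h]
    split_ifs
    · exact mul_nonneg hα.1.le (add_nonneg (hnn x) (hnn y))
    · linarith
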